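/- Let V be an n-dimensional real inner product space (n ≥ 3), W a real inner product space, and α : V × V → W a symmetric bilinear map. Suppose there is a symmetric bilinear form L on V with ⟨α(X,X),α(Y,Y)⟩ − ‖α(X,Y)‖² = L(X,X) + L(Y,Y) for all orthonormal X, Y. If the nullity space Δ = ker α is nonzero and the scalar curvature s of the associated Gauss curvature tensor is nonzero, then dim Δ = 1. -/

import Mathlib

open scoped RealInnerProductSpace

theorem aux_unit {V : Type*} [NormedAddCommGroup V] [InnerProductSpace ℝ V]
    [FiniteDimensional ℝ V] (D : Submodule ℝ V) {F : Type*} [AddCommGroup F] [Module ℝ F]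
    [FiniteDimensional ℝ F] (f : V →ₗ[ℝ] F)
    (h : Module.finrank ℝ F < Module.finrank ℝ D) : ∃ t ∈ D, ‖t‖ = 1 ∧ f t = 0 := by
  have h1 : LinearMap.ker (f.comp D.subtype) ≠ ⊥ := LinearMap.ker_ne_bot_of_finrank_lt h
  obtain ⟨x, hx, hx0⟩ := Submodule.exists_mem_ne_zero_of_ne_bot h1
  have hx1 : f (x : V) = 0 := by simpa using hx
  have hx2 : (x : V) ≠ 0 := by simpa using hx0
  refine ⟨(‖(x : V)‖)⁻¹ • (x : V), D.smul_mem _ x.2, ?_, ?_⟩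
  · have := norm_ne_zero_iff.2 hx2
    rw [norm_smul, norm_inv, norm_norm, inv_mul_cancel₀ this]
  · rw [map_smul, hx1, smul_zero]

theorem stmt_8 {V W : Type*} [NormedAddCommGroup V] [InnerProductSpace ℝ V]
    [NormedAddCommGroup W] [InnerProductSpace ℝ W]
    (n : ℕ) (hn : 3 ≤ n) (b : OrthonormalBasis (Fin n) ℝ V)
    (α : V →ₗ[ℝ] V →ₗ[ℝ] W) (hαsymm : ∀ x y, α x y = α y x)
    (L : V →ₗ[ℝ] V →ₗ[ℝ] ℝ) (hLsymm : ∀ x y, L x y = L y x)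
    (hCF : ∀ X Y : V, ‖X‖ = 1 → ‖Y‖ = 1 → ⟪X, Y⟫ = 0 →
      ⟪α X X, α Y Y⟫ - ‖α X Y‖ ^ 2 = L X X + L Y Y)
    (R : V → V → V → V → ℝ)
    (hR : ∀ X Y Z T, R X Y Z T = ⟪α X T, α Y Z⟫ - ⟪α X Z, α Y T⟫)
    (s : ℝ) (hs : s = ∑ i, ∑ j, R (b i) (b j) (b j) (b i))
    (hΔ : LinearMap.ker α ≠ ⊥) (hs0 : s ≠ 0) :
    Module.finrank ℝ (LinearMap.ker α) = 1 := by
  have : FiniteDimensional ℝ V := b.toBasis.finiteDimensional_of_finite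
  have hV : Module.finrank ℝ V = n := by simpa using Module.finrank_eq_card_basis b.toBasis
  by_contra hne
  have h0 : Module.finrank ℝ (LinearMap.ker α) ≠ 0 := by
    rwa [Ne, Submodule.finrank_eq_zero]
  have h2 : 1 < Module.finrank ℝ (LinearMap.ker α) := by omega
  have key : ∀ T X : V, T ∈ LinearMap.ker α → ‖T‖ = 1 → ‖X‖ = 1 → ⟪T, X⟫ = 0 →
      L T T + L X X = 0 := by
    intro T X hT h1 h2 h3
    have := hCF T X h1 h2 h3
    rw [LinearMap.mem_ker.1 hT] at this
    simpa using this.symm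
  have perp : ∀ X : V, ∃ T ∈ LinearMap.ker α, ‖T‖ = 1 ∧ ⟪X, T⟫ = 0 := by
    intro X
    obtain ⟨t, h, h', h''⟩ := aux_unit (LinearMap.ker α) (innerₛₗ ℝ X) (by simpa using h2)
    exact ⟨t, h, h', by simpa using h''⟩
  have hLT : ∀ T ∈ LinearMap.ker α, ‖T‖ = 1 → L T T = 0 := by
    intro T hT hT1
    obtain ⟨T', hT', hT1', hTT⟩ := perp T
    obtain ⟨X, -, hX1, hX⟩ := aux_unit (⊤ : Submodule ℝ V)
      ((innerₛₗ ℝ T).prod (innerₛₗ ℝ T')) (by simp; omega)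
    have hX' : ⟪T, X⟫ = 0 ∧ ⟪T', X⟫ = 0 := by simpa using hX
    have a1 := key T T' hT hT1 hT1' hTT
    have a2 := key T X hT hT1 hX1 hX'.1
    have a3 := key T' X hT' hT1' hX1 hX'.2
    linarith
  have hL : ∀ X, ‖X‖ = 1 → L X X = 0 := by
    intro X hX
    obtain ⟨T, hT, hT1, hXT⟩ := perp X
    have a1 := key T X hT hT1 hX (by rw [real_inner_comm]; exact hXT)
    rw [hLT T hT hT1] at a1
    linarith
  apply hs0
  rw [hs]
  refine Finset.sum_eq_zero fun i _ => Finset.sum_eq_zero fun j _ => ?_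
  rw [hR]
  by_cases hij : i = j
  · subst hij; simp
  · have := hCF (b i) (b j) (b.orthonormal.1 i) (b.orthonormal.1 j) (b.orthonormal.2 hij)
    rw [hL _ (b.orthonormal.1 i), hL _ (b.orthonormal.1 j)] at this
    rw [hαsymm (b j) (b i), real_inner_self_eq_norm_sq]
    linarith
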